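/- For every 0 ≤ i ≤ l−1 and 1 ≤ j ≤ n_{i+1}, the monomial x_{m_i + j}^{q^{m_i}} lies in the ideal I_{U_I} of P generated by the homogeneous U_I-invariants of positive degree; i.e., x_{m_i + j}^{q^{m_i}} ≡ 0 in the coinvariant algebra P_{U_I}. -/

import Mathlib

open MvPolynomial Finset

/-- The action of a matrix `g` on `F_q[x_1, …, x_n]`: the algebra map sending
`x_j` to `Σ_i g_{ij} x_i`. -/
noncomputable def matAct {K : Type*} [Field K] {n : ℕ} (g : Matrix (Fin n) (Fin n) K) :
    MvPolynomial (Fin n) K →ₐ[K] MvPolynomial (Fin n) K :=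
  aeval fun j => ∑ i, C (g i j) * X i

/-- The subalgebra of polynomials invariant under every matrix in `G`. -/
noncomputable def invariants {K : Type*} [Field K] {n : ℕ} (G : Set (GL (Fin n) K)) :
    Subalgebra K (MvPolynomial (Fin n) K) where
  carrier := {f | ∀ g ∈ G, matAct ((g : GL (Fin n) K) : Matrix (Fin n) (Fin n) K) f = f}
  mul_mem' := by
    intro a b ha hb g hg
    rw [map_mul, ha g hg, hb g hg]
  add_mem' := by
    intro a b ha hb g hg
    rw [map_add, ha g hg, hb g hg]
  algebraMap_mem' := by
    intro c g hg
    simp [matAct]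

/-- The ideal generated by the homogeneous `G`-invariants of positive degree;
the quotient by it is the algebra of coinvariants. -/
noncomputable def coinvIdeal {K : Type*} [Field K] {n : ℕ} (G : Set (GL (Fin n) K)) :
    Ideal (MvPolynomial (Fin n) K) :=
  Ideal.span {f | f ∈ invariants G ∧ ∃ d, 0 < d ∧ f.IsHomogeneous d}

/-- `tauf m s` is the largest partial sum `m i` which is `≤ s`; for `s` in the
`(j+1)`-st block this is `m j`. -/
def tauf {l : ℕ} (m : Fin (l + 1) → ℕ) (s : ℕ) : ℕ :=
  ((Finset.univ : Finset (Fin (l + 1))).filter fun i => m i ≤ s).sup m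

/-- `U_I`: block upper triangular matrices whose diagonal blocks are identity
matrices (blocks determined by the partial sums `m`). -/
def USet (K : Type*) [Field K] {l : ℕ} (n : ℕ) (m : Fin (l + 1) → ℕ) :
    Set (GL (Fin n) K) :=
  {g | ∀ s t : Fin n, tauf m (t : ℕ) ≤ tauf m (s : ℕ) →
    (g : Matrix (Fin n) (Fin n) K) s t = if s = t then 1 else 0}

/-- The global index of the `j`-th variable of the `i`-th block. -/
def emb {l : ℕ} (n : ℕ) (m : Fin (l + 1) → ℕ) (hmono : StrictMono m)
    (hlast : m (Fin.last l) = n) (i : Fin l)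
    (j : Fin (m i.succ - m i.castSucc)) : Fin n :=
  ⟨m i.castSucc + (j : ℕ), by
    have h1 : m i.succ ≤ n := hlast ▸ hmono.monotone (Fin.le_last _)
    have h2 := j.2
    omega⟩

/-- `G_I`: block upper triangular matrices whose `i`-th diagonal block lies in
`G i` (and whose entries above the diagonal blocks are arbitrary). -/
def GSet (K : Type*) [Field K] {l : ℕ} (n : ℕ) (m : Fin (l + 1) → ℕ)
    (hmono : StrictMono m) (hlast : m (Fin.last l) = n)
    (G : (i : Fin l) → Subgroup (GL (Fin (m i.succ - m i.castSucc)) K)) :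
    Set (GL (Fin n) K) :=
  {g | (∀ s t : Fin n, tauf m (t : ℕ) < tauf m (s : ℕ) →
          (g : Matrix (Fin n) (Fin n) K) s t = 0) ∧
    ∀ i : Fin l, ∃ h ∈ G i, ∀ j k : Fin (m i.succ - m i.castSucc),
      (g : Matrix (Fin n) (Fin n) K) (emb n m hmono hlast i j) (emb n m hmono hlast i k) =
        (h : Matrix (Fin (m i.succ - m i.castSucc)) (Fin (m i.succ - m i.castSucc)) K) j k}

/-- `Fpoly K k hk t = Π_{(λ_1,…,λ_k) ∈ K^k} (t + λ_1 x_1 + ⋯ + λ_k x_k)`. -/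
noncomputable def Fpoly (K : Type*) [Field K] [Fintype K] {n : ℕ} (k : ℕ) (hk : k ≤ n)
    (t : MvPolynomial (Fin n) K) : MvPolynomial (Fin n) K :=
  ∏ c : Fin k → K, (t + ∑ i : Fin k, C (c i) * X (Fin.castLE hk i))

/-- `v_{i,j} = F_{m_{i-1}}(x_{m_{i-1}+j})`. -/
noncomputable def vij (K : Type*) [Field K] [Fintype K] {l : ℕ} (n : ℕ)
    (m : Fin (l + 1) → ℕ) (hmono : StrictMono m) (hlast : m (Fin.last l) = n)
    (i : Fin l) (j : Fin (m i.succ - m i.castSucc)) : MvPolynomial (Fin n) K :=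
  Fpoly K (m i.castSucc)
    (le_trans (hmono.monotone (Fin.le_last _)) (le_of_eq hlast))
    (X (emb n m hmono hlast i j))

/-- The linear forms in the variables `x_s` with `s < k`. -/
noncomputable def initialForms (K : Type*) [Field K] [Fintype K] (n k : ℕ) :
    Finset (MvPolynomial (Fin n) K) := by
  classical
  exact (Fintype.piFinset fun s : Fin n => if (s : ℕ) < k then (univ : Finset K) else {0}).image
    fun a => ∑ s, C (a s) * X s

theorem mem_initialForms {K : Type*} [Field K] [Fintype K] {n k : ℕ}
    {v : MvPolynomial (Fin n) K} :
    v ∈ initialForms K n k ↔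
      ∃ a : Fin n → K, (∀ s : Fin n, k ≤ s → a s = 0) ∧ ∑ s, C (a s) * X s = v := by
  classical
  simp only [initialForms, mem_image, Fintype.mem_piFinset]
  refine exists_congr fun a => and_congr_left fun _ => forall_congr' fun s => ?_
  by_cases h : (s : ℕ) < k
  · simp [h]
  · simp [h, not_lt.mp h]

theorem card_initialForms (K : Type*) [Field K] [Fintype K] {n k : ℕ} (hk : k ≤ n) :
    #(initialForms K n k) = Fintype.card K ^ k := by
  classical
  rw [initialForms, card_image_of_injective, Fintype.card_piFinset]
  · have h : ∀ s : Fin n, #(if (s : ℕ) < k then (univ : Finset K) else {0}) =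
        if (s : ℕ) < k then Fintype.card K else 1 := by
      intro s
      split_ifs <;> simp
    simp only [h]
    rw [← prod_filter, prod_const, Fin.card_filter_val_lt, min_eq_right hk]
  · intro a b hab
    funext t
    simpa [coeff_sum, coeff_C_mul, coeff_X, Finsupp.single_left_inj] using
      congrArg (coeff (Finsupp.single t 1)) hab

theorem initialForms_add_mem {K : Type*} [Field K] [Fintype K] {n k : ℕ}
    {v w : MvPolynomial (Fin n) K} (hv : v ∈ initialForms K n k)
    (hw : w ∈ initialForms K n k) : v + w ∈ initialForms K n k := by
  rw [mem_initialForms] at *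
  obtain ⟨a, ha, rfl⟩ := hv
  obtain ⟨b, hb, rfl⟩ := hw
  exact ⟨a + b, fun s hs => by simp [ha s hs, hb s hs],
    by simp [add_mul, sum_add_distrib]⟩

theorem isHomogeneous_of_mem_initialForms {K : Type*} [Field K] [Fintype K] {n k : ℕ}
    {v : MvPolynomial (Fin n) K} (hv : v ∈ initialForms K n k) : v.IsHomogeneous 1 := by
  obtain ⟨a, -, rfl⟩ := mem_initialForms.mp hv
  exact IsHomogeneous.sum _ _ _ fun s _ => by
    simpa using (isHomogeneous_C (Fin n) (a s)).mul (isHomogeneous_X K s)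

theorem matAct_X {K : Type*} [Field K] {n : ℕ} (g : Matrix (Fin n) (Fin n) K) (t : Fin n) :
    matAct g (X t) = ∑ s, C (g s t) * X s := by
  simp [matAct]

theorem matAct_C {K : Type*} [Field K] {n : ℕ} (g : Matrix (Fin n) (Fin n) K) (a : K) :
    matAct g (C a) = C a := by
  simp [matAct]

theorem matAct_matAct {K : Type*} [Field K] {n : ℕ} (g h : Matrix (Fin n) (Fin n) K)
    (f : MvPolynomial (Fin n) K) : matAct g (matAct h f) = matAct (g * h) f := by
  rw [← AlgHom.comp_apply]
  congr 1
  ext1 t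
  simp only [AlgHom.comp_apply, matAct_X, map_sum, map_mul, matAct_C, Matrix.mul_apply,
    mul_sum, sum_mul]
  rw [sum_comm]
  exact sum_congr rfl fun _ _ => sum_congr rfl fun _ _ => by ring

theorem matAct_one {K : Type*} [Field K] {n : ℕ} (f : MvPolynomial (Fin n) K) :
    matAct 1 f = f := by
  have h : matAct (1 : Matrix (Fin n) (Fin n) K) = AlgHom.id K _ := by
    ext1 t
    simp [matAct_X, Matrix.one_apply]
  rw [h, AlgHom.id_apply]

theorem matAct_injective {K : Type*} [Field K] {n : ℕ} (g : GL (Fin n) K) :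
    Function.Injective (matAct (g : Matrix (Fin n) (Fin n) K)) :=
  Function.LeftInverse.injective (g := matAct (g⁻¹ : GL (Fin n) K).val) fun f => by
    rw [matAct_matAct, ← Units.val_mul, inv_mul_cancel, Units.val_one, matAct_one]

/-- If `g` sends each `x_t` with `t < k` to a linear form in the `x_s` with `s < k`, then it
permutes the linear forms in these variables. -/
theorem image_matAct_initialForms {K : Type*} [Field K] [Fintype K] {n k : ℕ}
    [DecidableEq (MvPolynomial (Fin n) K)] (g : GL (Fin n) K)
    (hg : ∀ s t : Fin n, (t : ℕ) < k → k ≤ s → g.val s t = 0) :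
    (initialForms K n k).image (matAct g.val) = initialForms K n k := by
  refine eq_of_subset_of_card_le (fun w hw => ?_)
    (card_image_of_injective _ (matAct_injective g)).ge
  obtain ⟨v, hv, rfl⟩ := mem_image.mp hw
  obtain ⟨a, ha, rfl⟩ := mem_initialForms.mp hv
  refine mem_initialForms.mpr ⟨fun s => ∑ t, g.val s t * a t, fun s hs => ?_, ?_⟩
  · refine sum_eq_zero fun t _ => ?_
    rcases lt_or_ge (t : ℕ) k with h | h
    · rw [hg s t h hs, zero_mul]
    · rw [ha t h, mul_zero]
  · simp only [map_sum, map_mul, matAct_C, matAct_X, mul_sum, sum_mul]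
    rw [sum_comm]
    exact sum_congr rfl fun _ _ => sum_congr rfl fun _ _ => by ring

/-- The monic polynomial whose roots are the linear forms in the `x_s` with `s < k`. -/
noncomputable def formsPoly (K : Type*) [Field K] [Fintype K] (n k : ℕ) :
    Polynomial (MvPolynomial (Fin n) K) :=
  ∏ v ∈ initialForms K n k, (Polynomial.X + Polynomial.C v)

theorem map_formsPoly {K : Type*} [Field K] [Fintype K] {n k : ℕ} (g : GL (Fin n) K)
    (hg : ∀ s t : Fin n, (t : ℕ) < k → k ≤ s → g.val s t = 0) :
    (formsPoly K n k).map (matAct g.val : _ →+* MvPolynomial (Fin n) K) =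
      formsPoly K n k := by
  classical
  conv_rhs => rw [formsPoly, ← image_matAct_initialForms g hg,
    prod_image (matAct_injective g).injOn]
  simp [formsPoly, Polynomial.map_prod]

theorem eval_add_formsPoly {K : Type*} [Field K] [Fintype K] {n k : ℕ}
    (t : MvPolynomial (Fin n) K) {w : MvPolynomial (Fin n) K}
    (hw : w ∈ initialForms K n k) :
    (formsPoly K n k).eval (t + w) = (formsPoly K n k).eval t := by
  classical
  have h : (initialForms K n k).image (w + ·) = initialForms K n k := by
    refine eq_of_subset_of_card_le (fun u hu => ?_)
      (card_image_of_injective _ (add_right_injective w)).ge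
    obtain ⟨v, hv, rfl⟩ := mem_image.mp hu
    exact initialForms_add_mem hw hv
  simp only [formsPoly, Polynomial.eval_prod, Polynomial.eval_add, Polynomial.eval_X,
    Polynomial.eval_C]
  conv_rhs => rw [← h, prod_image (add_right_injective w).injOn]
  exact prod_congr rfl fun _ _ => add_assoc _ _ _

theorem matAct_eval {K : Type*} [Field K] {n : ℕ} (g : Matrix (Fin n) (Fin n) K)
    (f : Polynomial (MvPolynomial (Fin n) K)) (t : MvPolynomial (Fin n) K) :
    matAct g (f.eval t) =
      (f.map (matAct g : _ →+* MvPolynomial (Fin n) K)).eval (matAct g t) :=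
  (Polynomial.eval_map_apply (matAct g : _ →+* MvPolynomial (Fin n) K) t).symm

theorem isHomogeneous_coeff_formsPoly {K : Type*} [Field K] [Fintype K] {n k : ℕ}
    (hk : k ≤ n) {d : ℕ} (hd : d ≤ Fintype.card K ^ k) :
    ((formsPoly K n k).coeff d).IsHomogeneous (Fintype.card K ^ k - d) := by
  classical
  rw [formsPoly, Finset.prod_X_add_C_coeff _ _ (by rwa [card_initialForms K hk]),
    card_initialForms K hk]
  refine IsHomogeneous.sum _ _ _ fun u hu => ?_
  obtain ⟨hsub, hcard⟩ := mem_powersetCard.mp hu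
  simpa [hcard] using IsHomogeneous.prod u id (fun _ => 1) fun v hv =>
    isHomogeneous_of_mem_initialForms (hsub hv)

theorem isHomogeneous_eval_formsPoly {K : Type*} [Field K] [Fintype K] {n k : ℕ}
    (hk : k ≤ n) (t : Fin n) :
    ((formsPoly K n k).eval (X t)).IsHomogeneous (Fintype.card K ^ k) := by
  rw [formsPoly, Polynomial.eval_prod]
  simpa [card_initialForms K hk] using
    IsHomogeneous.prod (initialForms K n k) (fun v => X t + v) (fun _ => 1) fun v hv =>
      (isHomogeneous_X K t).add (isHomogeneous_of_mem_initialForms hv)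

theorem eval_formsPoly {K : Type*} [Field K] [Fintype K] {n k : ℕ} (hk : k ≤ n)
    (t : MvPolynomial (Fin n) K) :
    (formsPoly K n k).eval t = t ^ Fintype.card K ^ k +
      ∑ d ∈ range (Fintype.card K ^ k), (formsPoly K n k).coeff d * t ^ d := by
  have hmonic : (formsPoly K n k).Monic :=
    Polynomial.monic_prod_of_monic _ _ fun v _ => Polynomial.monic_X_add_C v
  have hdeg : (formsPoly K n k).natDegree = Fintype.card K ^ k := by
    rw [formsPoly, Polynomial.natDegree_prod_of_monic _ _ fun v _ => Polynomial.monic_X_add_C v]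
    simp [card_initialForms K hk]
  rw [Polynomial.eval_eq_sum_range, hdeg, sum_range_succ, ← hdeg, hmonic.coeff_natDegree,
    one_mul, add_comm]

/-- If every element of `G` sends each `x_s` with `s < k` to a form in these variables, and
fixes `x_t` up to such a form, then `x_t ^ (q ^ k)` vanishes in the coinvariants. -/
theorem X_pow_mem_coinvIdeal {K : Type*} [Field K] [Fintype K] {n k : ℕ} (hk : k ≤ n)
    (G : Set (GL (Fin n) K)) (t : Fin n)
    (hG : ∀ g ∈ G, ∀ s u : Fin n, (u : ℕ) < k → k ≤ s → g.val s u = 0)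
    (ht : ∀ g ∈ G, ∀ s : Fin n, k ≤ s → g.val s t = if s = t then 1 else 0) :
    (X t : MvPolynomial (Fin n) K) ^ (Fintype.card K ^ k) ∈ coinvIdeal G := by
  rw [eq_sub_of_add_eq (eval_formsPoly hk (X t)).symm]
  refine sub_mem (Ideal.subset_span ⟨fun g hg => ?_, _, pow_pos Fintype.card_pos _,
    isHomogeneous_eval_formsPoly hk t⟩) (sum_mem fun d hd => Ideal.mul_mem_right _ _
      (Ideal.subset_span ⟨fun g hg => ?_, _, Nat.sub_pos_of_lt (mem_range.mp hd),
        isHomogeneous_coeff_formsPoly hk (mem_range.mp hd).le⟩))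
  · rw [matAct_eval, map_formsPoly g (hG g hg)]
    have hform : matAct g.val (X t) - X t ∈ initialForms K n k := by
      refine mem_initialForms.mpr ⟨fun s => g.val s t - if s = t then 1 else 0,
        fun s hs => sub_eq_zero.mpr (ht g hg s hs), ?_⟩
      simp [matAct_X, sub_mul, sum_sub_distrib, apply_ite C]
    simpa using eval_add_formsPoly (X t) hform
  · conv_rhs => rw [← map_formsPoly g (hG g hg), Polynomial.coeff_map]
    rfl

theorem tauf_mono {l : ℕ} (m : Fin (l + 1) → ℕ) : Monotone (tauf m) := fun _ _ h =>
  sup_mono (monotone_filter_right _ fun _ _ hi => hi.trans h)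

theorem le_tauf {l : ℕ} (m : Fin (l + 1) → ℕ) {i : Fin (l + 1)} {s : ℕ} (h : m i ≤ s) :
    m i ≤ tauf m s :=
  le_sup (f := m) (mem_filter.mpr ⟨mem_univ i, h⟩)

theorem tauf_le_of_lt_succ {l : ℕ} {m : Fin (l + 1) → ℕ} (hmono : StrictMono m) {i : Fin l}
    {s : ℕ} (h : s < m i.succ) : tauf m s ≤ m i.castSucc :=
  Finset.sup_le fun _ hj => hmono.monotone <| Fin.le_castSucc_iff.mpr <|
    hmono.lt_iff_lt.mp ((mem_filter.mp hj).2.trans_lt h)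

/-- for every `0 ≤ i ≤ l-1` and `1 ≤ j ≤ n_{i+1}`, the monomial
`x_{m_i+j}^{q^{m_i}}` lies in the ideal `I_{U_I}` generated by the homogeneous
`U_I`-invariants of positive degree, i.e. it vanishes in the coinvariant
algebra `P_{U_I}`. -/
theorem statement12 {K : Type*} [Field K] [Fintype K] {p r : ℕ} (hp : p.Prime)
    (hr : 0 < r) (hcard : Fintype.card K = p ^ r)
    (n l : ℕ) (hl : 0 < l) (m : Fin (l + 1) → ℕ)
    (hm0 : m 0 = 0) (hmono : StrictMono m) (hlast : m (Fin.last l) = n) :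
    ∀ (i : Fin l) (j : Fin (m i.succ - m i.castSucc)),
      (X (emb n m hmono hlast i j) : MvPolynomial (Fin n) K) ^
          (Fintype.card K ^ m i.castSucc) ∈
        coinvIdeal (USet K n m) := by
  intro i j
  have hk : m i.castSucc ≤ n := hlast ▸ hmono.monotone (Fin.le_last _)
  have hlt : (emb n m hmono hlast i j : ℕ) < m i.succ := by
    have := j.2
    simp only [emb]
    omega
  refine X_pow_mem_coinvIdeal hk _ _ (fun g hg s u hu hs => ?_)
    fun g hg s hs => hg s _ ((tauf_le_of_lt_succ hmono hlt).trans (le_tauf m hs))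
  rw [hg s u (tauf_mono m (hu.le.trans hs)), if_neg]
  rintro rfl
  exact absurd hu hs.not_gt
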